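/- Subject Reduction for resident policies with dynamic membranes: if Θ ⊢ N : ok, N is coherent, and N → N' under the dynamic-membrane reduction, then Θ ⊢ N' : ok and N' is coherent. -/

import Mathlib

universe u

/-! ## Basic framework: trust levels, agents, membranes, systems -/

/-- Trust levels: `loc` (unknown), `lgood`, `lbad`. -/
inductive TrustLev : Type where
  | loc : TrustLev
  | lgood : TrustLev
  | lbad : TrustLev
deriving DecidableEq

/-- The subtyping order `<:` on trust levels: it is reflexive and satisfies
`loc <: lgood` and `loc <: lbad`. -/
def TrustLev.sub (t1 t2 : TrustLev) : Prop := t1 = t2 ∨ t1 = TrustLev.loc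

/-- Agents, parametric on the type `Act` of basic actions, the type `Loc` of
localities, and the type `Pol` of policies (digests carried by `go`). -/
inductive Agent (Act Loc : Type) (Pol : Type u) where
  | nil : Agent Act Loc Pol
  | act : Act → Agent Act Loc Pol → Agent Act Loc Pol
  | go : Loc → Pol → Agent Act Loc Pol → Agent Act Loc Pol
  | par : Agent Act Loc Pol → Agent Act Loc Pol → Agent Act Loc Pol
  | repl : Agent Act Loc Pol → Agent Act Loc Pol

/-- A membrane: a trust function on localities together with a policy.
(The partial trust function is modelled as a total function, the level `loc`
standing for ``unknown''.) -/
structure Membrane (Loc : Type) (Pol : Type u) where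
  trust : Loc → TrustLev
  pol : Pol

/-- Systems: the empty system, a site `l[M]{P}`, or a parallel composition. -/
inductive System (Act Loc : Type) (Pol : Type u) where
  | empty : System Act Loc Pol
  | site : Loc → Membrane Loc Pol → Agent Act Loc Pol → System Act Loc Pol
  | par : System Act Loc Pol → System Act Loc Pol → System Act Loc Pol

variable {Act Loc : Type} {Pol : Type u}

/-- The list of sites (name and membrane) occurring in a system. -/
def System.sites : System Act Loc Pol → List (Loc × Membrane Loc Pol)
  | System.empty => []
  | System.site l M _ => [(l, M)]
  | System.par N1 N2 => N1.sites ++ N2.sites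

/-- A site named `l` with membrane `M` is trustworthy if `M_t(l) = lgood`. -/
def Trustworthy (l : Loc) (M : Membrane Loc Pol) : Prop :=
  M.trust l = TrustLev.lgood

/-- A system is coherent if `M^k_t(l) <: M^l_t(l)` for every trustworthy site `k`
and every site `l` of the system. -/
def Coherent (N : System Act Loc Pol) : Prop :=
  ∀ p ∈ N.sites, Trustworthy p.1 p.2 →
    ∀ q ∈ N.sites, TrustLev.sub (p.2.trust q.1) (q.2.trust q.1)

/-- `SiteIn l M P N` holds when the site `l[M]{P}` occurs in the system `N`. -/
inductive SiteIn (l : Loc) (M : Membrane Loc Pol) (P : Agent Act Loc Pol) :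
    System Act Loc Pol → Prop where
  | here : SiteIn l M P (System.site l M P)
  | left {N1 N2} : SiteIn l M P N1 → SiteIn l M P (System.par N1 N2)
  | right {N1 N2} : SiteIn l M P N2 → SiteIn l M P (System.par N1 N2)

/-- Structural equivalence on agents: `|` is commutative and associative with
unit `nil`, replication unfolds, and `≡` is a congruence for `|`. -/
inductive AgEq : Agent Act Loc Pol → Agent Act Loc Pol → Prop where
  | refl (P) : AgEq P P
  | symm {P Q} : AgEq P Q → AgEq Q P
  | trans {P Q R} : AgEq P Q → AgEq Q R → AgEq P R
  | parNil (P) : AgEq (Agent.par P Agent.nil) P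
  | parComm (P Q) : AgEq (Agent.par P Q) (Agent.par Q P)
  | parAssoc (P Q R) :
      AgEq (Agent.par (Agent.par P Q) R) (Agent.par P (Agent.par Q R))
  | replUnfold (P Q) :
      AgEq (Agent.par (Agent.repl P) Q) (Agent.par P (Agent.par (Agent.repl P) Q))
  | parCong {P P' Q Q'} : AgEq P P' → AgEq Q Q' → AgEq (Agent.par P Q) (Agent.par P' Q')

/-- Structural equivalence on systems. -/
inductive StrEq : System Act Loc Pol → System Act Loc Pol → Prop where
  | refl (N) : StrEq N N
  | symm {N1 N2} : StrEq N1 N2 → StrEq N2 N1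
  | trans {N1 N2 N3} : StrEq N1 N2 → StrEq N2 N3 → StrEq N1 N3
  | parEmpty (N) : StrEq (System.par N System.empty) N
  | parComm (N1 N2) : StrEq (System.par N1 N2) (System.par N2 N1)
  | parAssoc (N1 N2 N3) :
      StrEq (System.par (System.par N1 N2) N3) (System.par N1 (System.par N2 N3))
  | parCong {N1 N1' N2 N2'} :
      StrEq N1 N1' → StrEq N2 N2' → StrEq (System.par N1 N2) (System.par N1' N2')
  | site (l M) {P Q} : AgEq P Q → StrEq (System.site l M P) (System.site l M Q)

/-- The reduction relation over systems, parametric on the `enforces`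
relation `enf` between policies and on the typechecking relation `typ`
between agents and policies.  In rule `mig`, if the target site `l` trusts
the source site `k` then the digest `T` is checked against `l`'s policy,
otherwise the full code `P` is typechecked. -/
inductive Red (enf : Pol → Pol → Prop) (typ : Agent Act Loc Pol → Pol → Prop) :
    System Act Loc Pol → System Act Loc Pol → Prop where
  | act (l M a P Q) :
      Red enf typ (System.site l M (Agent.par (Agent.act a P) Q))
        (System.site l M (Agent.par P Q))
  | par {N1 N1'} (N2) :
      Red enf typ N1 N1' → Red enf typ (System.par N1 N2) (System.par N1' N2)
  | struct {N N1 N1' N'} :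
      StrEq N N1 → Red enf typ N1 N1' → StrEq N1' N' → Red enf typ N N'
  | mig (k Mk l Ml T P Q R) :
      (if Ml.trust k = TrustLev.lgood then enf T Ml.pol else typ P Ml.pol) →
      Red enf typ
        (System.par (System.site k Mk (Agent.par (Agent.go l T P) Q))
          (System.site l Ml R))
        (System.par (System.site k Mk Q) (System.site l Ml (Agent.par P R)))

/-- The labelled transition system over agents, with labels in `Act ⊕ Loc`. -/
inductive Step : Agent Act Loc Pol → (Act ⊕ Loc) → Agent Act Loc Pol → Prop where
  | act (a P) : Step (Agent.act a P) (Sum.inl a) P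
  | mig (l T P) : Step (Agent.go l T P) (Sum.inr l) Agent.nil
  | repl {P α P'} :
      Step (Agent.par P (Agent.repl P)) α P' → Step (Agent.repl P) α P'
  | parL {P1 α P1'} (P2) :
      Step P1 α P1' → Step (Agent.par P1 P2) α (Agent.par P1' P2)
  | parR {P1 α P1'} (P2) :
      Step P1 α P1' → Step (Agent.par P2 P1) α (Agent.par P2 P1')

/-- `Trace P σ P'` means `P →σ P'`: the composite of the single steps of `σ`. -/
inductive Trace : Agent Act Loc Pol → List (Act ⊕ Loc) → Agent Act Loc Pol → Prop where
  | nil (P) : Trace P [] P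
  | cons {P α P' σ P''} : Step P α P' → Trace P' σ P'' → Trace P (α :: σ) P''

/-- The thread components of an agent: every agent is `P1 | ... | Pn`
with each `Pi` a thread (not itself a parallel composition). -/
def Agent.comps : Agent Act Loc Pol → List (Agent Act Loc Pol)
  | Agent.par P Q => P.comps ++ Q.comps
  | P => [P]

/-- A thread is an agent which is not a parallel composition. -/
def Agent.IsThread : Agent Act Loc Pol → Prop
  | Agent.par _ _ => False
  | _ => True

/-! ## Multiset policies -/

/-- A multiset policy: a multiset over `Act ⊕ Loc` with multiplicities in
`ℕ ∪ {ω}` (i.e. `ℕ∞`) and finite support.  Multiset sum is `+` (with `ω = ⊤`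
absorbing) and multiset inclusion is the pointwise order `≤`. -/
abbrev MPolicy (Act Loc : Type) : Type := (Act ⊕ Loc) →₀ ℕ∞

/-- `T^ω`: the multiset assigning `ω` to every element of the support of `T`. -/
noncomputable def omegafy (T : MPolicy Act Loc) : MPolicy Act Loc :=
  Finsupp.mapRange (fun n => if n = 0 then 0 else (⊤ : ℕ∞)) (by simp) T

/-- Typechecking of agents against multiset policies, `⊢ P : T`. -/
inductive MTypes : Agent Act Loc (MPolicy Act Loc) → MPolicy Act Loc → Prop where
  | nil (T) : MTypes Agent.nil T
  | act {a P T} :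
      MTypes P T → MTypes (Agent.act a P) (T + Finsupp.single (Sum.inl a) 1)
  | go {l T' P T} :
      MTypes P T' → MTypes (Agent.go l T' P) (T + Finsupp.single (Sum.inr l) 1)
  | par {P Q T1 T2} :
      MTypes P T1 → MTypes Q T2 → MTypes (Agent.par P Q) (T1 + T2)
  | repl {P T T'} : MTypes P T → omegafy T ≤ T' → MTypes (Agent.repl P) T'

/-- `Sset σ`: the multiset of labels occurring in the trace `σ`. -/
noncomputable def Sset (σ : List (Act ⊕ Loc)) : MPolicy Act Loc :=
  (σ.map fun α => Finsupp.single α (1 : ℕ∞)).sum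

/-- Well-formedness of systems for multiset (entry) policies: at a trustworthy
site every thread component of the resident code typechecks against the
membrane's policy. -/
inductive OkM : System Act Loc (MPolicy Act Loc) → Prop where
  | empty : OkM System.empty
  | par {N1 N2} : OkM N1 → OkM N2 → OkM (System.par N1 N2)
  | siteU {l M P} : ¬ Trustworthy l M → OkM (System.site l M P)
  | siteG {l M P} :
      Trustworthy l M → (∀ Pi ∈ Agent.comps P, MTypes Pi M.pol) →
      OkM (System.site l M P)

/-! ## Policy inference (minimal multiset policies) -/

/-- Policy inference `⊩ P : T`, computing the minimal multiset policy of an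
agent: `⊩nil:∅`; `⊩a.P:T∪{a}` if `⊩P:T`; `⊩go(l,T).P:{l}` if `⊩P:T'` for some
`T' ≤ T`; `⊩P|Q:T1∪T2`; `⊩!P:T^ω`. -/
inductive MInf : Agent Act Loc (MPolicy Act Loc) → MPolicy Act Loc → Prop where
  | nil : MInf Agent.nil 0
  | act {a P T} :
      MInf P T → MInf (Agent.act a P) (T + Finsupp.single (Sum.inl a) 1)
  | go {l T P T'} :
      MInf P T' → T' ≤ T → MInf (Agent.go l T P) (Finsupp.single (Sum.inr l) 1)
  | par {P Q T1 T2} :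
      MInf P T1 → MInf Q T2 → MInf (Agent.par P Q) (T1 + T2)
  | repl {P T} : MInf P T → MInf (Agent.repl P) (omegafy T)

/-! ## Resident policies and dynamic membranes -/

/-- The dynamic-membrane reduction relation.  In rule `mig`, letting `T'` be
the digest `T` if the source is trusted and `ptype(P)` otherwise, the side
condition is `T' ≤ M^l_p`, `M^l_p = M̂^l_p ∪ T'` and `M̂^l_t = M^l_t`: the
target membrane's policy decreases by the resources allocated to `P`. -/
inductive RedD :
    System Act Loc (MPolicy Act Loc) → System Act Loc (MPolicy Act Loc) → Prop where
  | act (l M a P Q) :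
      RedD (System.site l M (Agent.par (Agent.act a P) Q))
        (System.site l M (Agent.par P Q))
  | par {N1 N1'} (N2) : RedD N1 N1' → RedD (System.par N1 N2) (System.par N1' N2)
  | struct {N N1 N1' N'} : StrEq N N1 → RedD N1 N1' → StrEq N1' N' → RedD N N'
  | mig (k Mk l Ml Mlhat T T' P Q R) :
      (if Ml.trust k = TrustLev.lgood then T' = T else MInf P T') →
      T' ≤ Ml.pol →
      Ml.pol = Mlhat.pol + T' →
      Mlhat.trust = Ml.trust →
      RedD
        (System.par (System.site k Mk (Agent.par (Agent.go l T P) Q))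
          (System.site l Ml R))
        (System.par (System.site k Mk Q) (System.site l Mlhat (Agent.par P R)))

/-- Well-formedness relative to an external record `Θ` of the original
resident policies: `Θ ⊢ l[M]{P} : ok` for trustworthy `l` iff
`ptype(P) ∪ M_p ≤ Θ(l)`. -/
inductive ThOk (Θ : Loc → MPolicy Act Loc) :
    System Act Loc (MPolicy Act Loc) → Prop where
  | empty : ThOk Θ System.empty
  | par {N1 N2} : ThOk Θ N1 → ThOk Θ N2 → ThOk Θ (System.par N1 N2)
  | siteU {l M P} : ¬ Trustworthy l M → ThOk Θ (System.site l M P)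
  | siteG {l M P T} :
      Trustworthy l M → MInf P T → T + M.pol ≤ Θ l → ThOk Θ (System.site l M P)

theorem MInf.uniq {P : Agent Act Loc (MPolicy Act Loc)} {T T' : MPolicy Act Loc}
    (h : MInf P T) (h' : MInf P T') : T = T' := by
  induction h generalizing T' with
  | nil => cases h'; rfl
  | act _ ih => cases h' with | act h2 => rw [ih h2]
  | go _ _ _ => cases h' with | go h2 _ => rfl
  | par _ _ ih1 ih2 => cases h' with | par h1 h2 => rw [ih1 h1, ih2 h2]
  | repl _ ih => cases h' with | repl h2 => rw [ih h2]

theorem add_omegafy_eq (T : MPolicy Act Loc) : T + omegafy T = omegafy T := by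
  ext x
  by_cases h : T x = 0 <;> simp [omegafy, h]

theorem AgEq.minf {P Q : Agent Act Loc (MPolicy Act Loc)} (h : AgEq P Q) :
    ∀ T, MInf P T ↔ MInf Q T := by
  induction h with
  | refl P => intro T; rfl
  | symm _ ih => intro T; exact (ih T).symm
  | trans _ _ ih1 ih2 => intro T; exact (ih1 T).trans (ih2 T)
  | parNil P =>
    intro T
    constructor
    · rintro (_ | _ | _ | ⟨h1, h2⟩ | _)
      cases h2
      simpa using h1
    · intro h
      simpa using MInf.par h MInf.nil
  | parComm P Q =>
    intro T
    constructor <;>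
    · rintro (_ | _ | _ | ⟨h1, h2⟩ | _)
      rw [add_comm]
      exact MInf.par h2 h1
  | parAssoc P Q R =>
    intro T
    constructor
    · rintro (_ | _ | _ | ⟨h1, h2⟩ | _)
      cases h1 with
      | par h3 h4 =>
        rw [add_assoc]
        exact MInf.par h3 (MInf.par h4 h2)
    · rintro (_ | _ | _ | ⟨h1, h2⟩ | _)
      cases h2 with
      | par h3 h4 =>
        rw [← add_assoc]
        exact MInf.par (MInf.par h1 h3) h4
  | replUnfold P Q =>
    intro T
    constructor
    · rintro (_ | _ | _ | ⟨h1, h2⟩ | _)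
      cases h1 with
      | repl h3 =>
        rw [← add_omegafy_eq, add_assoc]
        exact MInf.par h3 (MInf.par (MInf.repl h3) h2)
    · rintro (_ | _ | _ | ⟨h1, h2⟩ | _)
      cases h2 with
      | par h3 h4 =>
        cases h3 with
        | repl h5 =>
          rw [h1.uniq h5, ← add_assoc, add_omegafy_eq]
          exact MInf.par (MInf.repl h5) h4
  | parCong _ _ ih1 ih2 =>
    intro T
    constructor
    · rintro (_ | _ | _ | ⟨h1, h2⟩ | _)
      exact MInf.par ((ih1 _).1 h1) ((ih2 _).1 h2)
    · rintro (_ | _ | _ | ⟨h1, h2⟩ | _)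
      exact MInf.par ((ih1 _).2 h1) ((ih2 _).2 h2)

theorem thOk_par {Θ : Loc → MPolicy Act Loc} {N1 N2 : System Act Loc (MPolicy Act Loc)} :
    ThOk Θ (System.par N1 N2) ↔ ThOk Θ N1 ∧ ThOk Θ N2 :=
  ⟨fun h => by cases h with | par h1 h2 => exact ⟨h1, h2⟩, fun h => ThOk.par h.1 h.2⟩

theorem thOk_empty {Θ : Loc → MPolicy Act Loc} :
    ThOk Θ (System.empty : System Act Loc (MPolicy Act Loc)) ↔ True :=
  ⟨fun _ => trivial, fun _ => ThOk.empty⟩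

theorem thOk_site {Θ : Loc → MPolicy Act Loc} {l : Loc} {M : Membrane Loc (MPolicy Act Loc)}
    {P : Agent Act Loc (MPolicy Act Loc)} :
    ThOk Θ (System.site l M P) ↔ (Trustworthy l M → ∃ T, MInf P T ∧ T + M.pol ≤ Θ l) := by
  constructor
  · intro h ht
    cases h with
    | siteU h => exact absurd ht h
    | siteG _ h1 h2 => exact ⟨_, h1, h2⟩
  · intro h
    by_cases ht : Trustworthy l M
    · obtain ⟨T, h1, h2⟩ := h ht
      exact ThOk.siteG ht h1 h2
    · exact ThOk.siteU ht

theorem StrEq.thOk {Θ : Loc → MPolicy Act Loc} {N N' : System Act Loc (MPolicy Act Loc)}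
    (h : StrEq N N') : ThOk Θ N ↔ ThOk Θ N' := by
  induction h with
  | refl => rfl
  | symm _ ih => exact ih.symm
  | trans _ _ ih1 ih2 => exact ih1.trans ih2
  | parEmpty N => simp [thOk_par, thOk_empty]
  | parComm N1 N2 => simp only [thOk_par, and_comm]
  | parAssoc N1 N2 N3 => simp only [thOk_par, and_assoc]
  | parCong _ _ ih1 ih2 => simp only [thOk_par, ih1, ih2]
  | site l M h => simp only [thOk_site, h.minf]

/-- The names and trust functions of the sites of a system. -/
def System.trusts (N : System Act Loc Pol) : Set (Loc × (Loc → TrustLev)) :=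
  {x | ∃ p ∈ N.sites, x = (p.1, p.2.trust)}

theorem trusts_par (N1 N2 : System Act Loc Pol) :
    (System.par N1 N2).trusts = N1.trusts ∪ N2.trusts := by
  ext x
  simp only [System.trusts, System.sites, List.mem_append, Set.mem_setOf_eq, Set.mem_union]
  constructor
  · rintro ⟨p, h | h, e⟩
    · exact Or.inl ⟨p, h, e⟩
    · exact Or.inr ⟨p, h, e⟩
  · rintro (⟨p, h, e⟩ | ⟨p, h, e⟩)
    · exact ⟨p, Or.inl h, e⟩
    · exact ⟨p, Or.inr h, e⟩

theorem trusts_site (l : Loc) (M : Membrane Loc Pol) (P : Agent Act Loc Pol) :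
    (System.site l M P).trusts = {(l, M.trust)} := by
  ext x
  simp [System.trusts, System.sites]

theorem trusts_empty : (System.empty : System Act Loc Pol).trusts = ∅ := by
  ext x
  simp [System.trusts, System.sites]

theorem coherent_iff (N : System Act Loc Pol) :
    Coherent N ↔ ∀ x ∈ N.trusts, x.2 x.1 = TrustLev.lgood →
      ∀ y ∈ N.trusts, TrustLev.sub (x.2 y.1) (y.2 y.1) := by
  constructor
  · rintro h _ ⟨p, hp, rfl⟩ ht _ ⟨q, hq, rfl⟩
    exact h p hp ht q hq
  · intro h p hp ht q hq
    exact h _ ⟨p, hp, rfl⟩ ht _ ⟨q, hq, rfl⟩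

theorem StrEq.trusts {N N' : System Act Loc Pol} (h : StrEq N N') : N.trusts = N'.trusts := by
  induction h with
  | refl => rfl
  | symm _ ih => exact ih.symm
  | trans _ _ ih1 ih2 => exact ih1.trans ih2
  | parEmpty N => simp [trusts_par, trusts_empty]
  | parComm N1 N2 => simp only [trusts_par, Set.union_comm]
  | parAssoc N1 N2 N3 => simp only [trusts_par, Set.union_assoc]
  | parCong _ _ ih1 ih2 => simp only [trusts_par, ih1, ih2]
  | site l M h => simp only [trusts_site]

theorem RedD.trusts {N N' : System Act Loc (MPolicy Act Loc)} (h : RedD N N') :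
    N.trusts = N'.trusts := by
  induction h with
  | act => simp only [trusts_site]
  | par _ _ ih => simp only [trusts_par, ih]
  | struct h1 _ h2 ih => exact (h1.trusts.trans ih).trans h2.trusts
  | mig k Mk l Ml Mlhat T T' P Q R _ _ _ h => simp only [trusts_par, trusts_site, h]

theorem RedD.thOk {Θ : Loc → MPolicy Act Loc} {N N' : System Act Loc (MPolicy Act Loc)}
    (hred : RedD N N') (hok : ThOk Θ N) (hcoh : Coherent N) : ThOk Θ N' := by
  induction hred with
  | act l M a P Q =>
    rw [thOk_site] at hok ⊢
    intro ht
    obtain ⟨T, h1, h2⟩ := hok ht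
    rcases h1 with _ | _ | _ | ⟨h3, h4⟩ | _
    cases h3 with
    | act h5 =>
      refine ⟨_, MInf.par h5 h4, le_trans ?_ h2⟩
      gcongr
      exact le_self_add
  | par N2 _ ih =>
    rw [thOk_par] at hok ⊢
    refine ⟨ih hok.1 ?_, hok.2⟩
    intro p hp ht q hq
    exact hcoh p (List.mem_append_left _ hp) ht q (List.mem_append_left _ hq)
  | struct h1 _ h2 ih =>
    refine h2.thOk.1 (ih (h1.thOk.1 hok) ?_)
    rw [coherent_iff] at hcoh ⊢
    rwa [← h1.trusts]
  | mig k Mk l Ml Mlhat T T' P Q R hc hle hpol htr =>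
    rw [thOk_par, thOk_site, thOk_site] at hok ⊢
    obtain ⟨hk, hl⟩ := hok
    constructor
    · intro ht
      obtain ⟨S, h1, h2⟩ := hk ht
      rcases h1 with _ | _ | _ | ⟨h3, h4⟩ | _
      refine ⟨_, h4, le_trans ?_ h2⟩
      gcongr
      exact le_add_self
    · intro ht
      have ht' : Trustworthy l Ml := by
        unfold Trustworthy at ht ⊢
        rwa [← htr]
      obtain ⟨S, h1, h2⟩ := hl ht'
      have key : ∃ U, MInf P U ∧ U ≤ T' := by
        split_ifs at hc with hg
        · subst hc
          have hs := hcoh (l, Ml) (by simp [System.sites]) ht' (k, Mk) (by simp [System.sites])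
          have hkt : Trustworthy k Mk := by
            rcases hs with hs | hs
            · exact hs.symm.trans hg
            · simp only [hg] at hs
              cases hs
          obtain ⟨V, h3, _⟩ := hk hkt
          rcases h3 with _ | _ | _ | ⟨h4, h5⟩ | _
          cases h4 with
          | go h6 h7 => exact ⟨_, h6, h7⟩
        · exact ⟨_, hc, le_rfl⟩
      obtain ⟨U, hU, hUT⟩ := key
      refine ⟨_, MInf.par hU h1, le_trans ?_ h2⟩
      rw [hpol, add_comm U S, add_assoc, add_comm U]
      gcongr

/-- **Subject Reduction for resident policies with dynamic membranes**: if
`Θ ⊢ N : ok`, `N` is coherent, and `N → N'` under the dynamic-membrane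
reduction, then `Θ ⊢ N' : ok` and `N'` is coherent. -/
theorem subject_reduction_resident
    {Θ : Loc → MPolicy Act Loc} {N N' : System Act Loc (MPolicy Act Loc)}
    (hok : ThOk Θ N) (hcoh : Coherent N) (hred : RedD N N') :
    ThOk Θ N' ∧ Coherent N' := by
  refine ⟨hred.thOk hok hcoh, ?_⟩
  rw [coherent_iff] at hcoh ⊢
  rwa [← hred.trusts]
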